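/- The metric g determined by the real constants a, b, p, q, s is conformally flat (i.e. its Weyl tensor W_{ijkh} vanishes identically on ℝ⁴) if and only if b = a, s = p and q = 0. -/

import Mathlib

noncomputable section

open scoped BigOperators

/-- The metric of a four-dimensional two-symmetric Lorentzian manifold, in
coordinates `x 0 = x¹, x 1 = x², x 2 = x³, x 3 = x⁴`:
`g₁₄ = g₄₁ = g₂₂ = g₃₃ = 1`,
`g₄₄ = x⁴(a(x²)² + b(x³)²) + p(x²)² + 2q x²x³ + s(x³)²`, all others zero. -/
def gmat (a b p q s : ℝ) (x : Fin 4 → ℝ) : Matrix (Fin 4) (Fin 4) ℝ :=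
  Matrix.of fun i j =>
    if i = 0 ∧ j = 3 then 1
    else if i = 3 ∧ j = 0 then 1
    else if i = 1 ∧ j = 1 then 1
    else if i = 2 ∧ j = 2 then 1
    else if i = 3 ∧ j = 3 then
      x 3 * (a * (x 1) ^ 2 + b * (x 2) ^ 2) + p * (x 1) ^ 2
        + 2 * q * x 1 * x 2 + s * (x 2) ^ 2
    else 0

/-- The inverse matrix `g^{ij}`. -/
def ginv (a b p q s : ℝ) (x : Fin 4 → ℝ) : Matrix (Fin 4) (Fin 4) ℝ :=
  (gmat a b p q s x)⁻¹

/-- Partial derivative `∂_i` of a function on ℝ⁴. -/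
def pd (i : Fin 4) (f : (Fin 4 → ℝ) → ℝ) (x : Fin 4 → ℝ) : ℝ :=
  fderiv ℝ f x (Pi.single i 1)

/-- Christoffel symbols `Γ^k_{ij} = (1/2) Σ_l g^{kl}(∂_i g_{jl} + ∂_j g_{il} − ∂_l g_{ij})`. -/
def Gam (a b p q s : ℝ) (k i j : Fin 4) (x : Fin 4 → ℝ) : ℝ :=
  (1 / 2) * ∑ l, ginv a b p q s x k l *
    (pd i (fun y => gmat a b p q s y j l) x
      + pd j (fun y => gmat a b p q s y i l) x
      - pd l (fun y => gmat a b p q s y i j) x)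

/-- Curvature tensor
`R^i_{jkl} = ∂_k Γ^i_{lj} − ∂_l Γ^i_{kj} + Σ_m (Γ^i_{km} Γ^m_{lj} − Γ^i_{lm} Γ^m_{kj})`. -/
def Riem (a b p q s : ℝ) (i j k l : Fin 4) (x : Fin 4 → ℝ) : ℝ :=
  pd k (Gam a b p q s i l j) x - pd l (Gam a b p q s i k j) x
    + ∑ m, (Gam a b p q s i k m x * Gam a b p q s m l j x
      - Gam a b p q s i l m x * Gam a b p q s m k j x)

/-- Ricci tensor `ρ_{jl} = Σ_i R^i_{jil}`. -/
def Ric (a b p q s : ℝ) (j l : Fin 4) (x : Fin 4 → ℝ) : ℝ :=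
  ∑ i, Riem a b p q s i j i l x

/-- Lowered curvature tensor `R_{ijkh} = Σ_m g_{im} R^m_{jkh}`. -/
def Rlow (a b p q s : ℝ) (i j k h : Fin 4) (x : Fin 4 → ℝ) : ℝ :=
  ∑ m, gmat a b p q s x i m * Riem a b p q s m j k h x

/-- Scalar curvature `τ = Σ_{j,l} g^{jl} ρ_{jl}`. -/
def scal (a b p q s : ℝ) (x : Fin 4 → ℝ) : ℝ :=
  ∑ j, ∑ l, ginv a b p q s x j l * Ric a b p q s j l x

/-- Weyl tensor `W_{ijkh} = R_{ijkh} − (1/2)(g_{ik}ρ_{jh} + g_{jh}ρ_{ik} − g_{ih}ρ_{jk} − g_{jk}ρ_{ih})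
+ (τ/6)(g_{ik}g_{jh} − g_{ih}g_{jk})`. -/
def Weyl (a b p q s : ℝ) (i j k h : Fin 4) (x : Fin 4 → ℝ) : ℝ :=
  Rlow a b p q s i j k h x
    - (1 / 2) * (gmat a b p q s x i k * Ric a b p q s j h x
      + gmat a b p q s x j h * Ric a b p q s i k x
      - gmat a b p q s x i h * Ric a b p q s j k x
      - gmat a b p q s x j k * Ric a b p q s i h x)
    + (scal a b p q s x / 6) * (gmat a b p q s x i k * gmat a b p q s x j h
      - gmat a b p q s x i h * gmat a b p q s x j k)

/-- The coefficient `g₄₄` of the metric. -/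
def profile (a b p q s : ℝ) (x : Fin 4 → ℝ) : ℝ :=
  x 3 * (a * (x 1) ^ 2 + b * (x 2) ^ 2) + p * (x 1) ^ 2
    + 2 * q * x 1 * x 2 + s * (x 2) ^ 2

/-- Half the gradient of `profile`. -/
def halfGrad (a b p q s : ℝ) (x : Fin 4 → ℝ) : Fin 4 → ℝ :=
  ![0, (a * x 3 + p) * x 1 + q * x 2, (b * x 3 + s) * x 2 + q * x 1,
    (a * (x 1) ^ 2 + b * (x 2) ^ 2) / 2]

/-- Half the Hessian matrix of `profile`. -/
def halfHess (a b p q s : ℝ) (x : Fin 4 → ℝ) : Matrix (Fin 4) (Fin 4) ℝ :=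
  !![0, 0, 0, 0;
     0, a * x 3 + p, q, a * x 1;
     0, q, b * x 3 + s, b * x 2;
     0, a * x 1, b * x 2, 0]

lemma gmat_eq (a b p q s : ℝ) (x : Fin 4 → ℝ) :
    gmat a b p q s x =
      !![0, 0, 0, 1; 0, 1, 0, 0; 0, 0, 1, 0; 1, 0, 0, profile a b p q s x] := by
  ext i j
  fin_cases i <;> fin_cases j <;> simp [gmat, profile]

lemma ginv_eq (a b p q s : ℝ) (x : Fin 4 → ℝ) :
    ginv a b p q s x =
      !![-profile a b p q s x, 0, 0, 1; 0, 1, 0, 0; 0, 0, 1, 0; 1, 0, 0, 0] := by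
  rw [ginv, gmat_eq]
  refine Matrix.inv_eq_right_inv ?_
  ext i j
  fin_cases i <;> fin_cases j <;> simp [Matrix.mul_apply, Fin.sum_univ_four]

@[simp] lemma pd_const (i : Fin 4) (c : ℝ) (x : Fin 4 → ℝ) : pd i (fun _ => c) x = 0 := by
  simp [pd]

lemma pd_neg (i : Fin 4) (f : (Fin 4 → ℝ) → ℝ) (x : Fin 4 → ℝ) :
    pd i (fun y => -f y) x = -pd i f x := by
  simp [pd]

lemma pd_coord (i k : Fin 4) (x : Fin 4 → ℝ) :
    pd i (fun y => y k) x = if k = i then 1 else 0 := by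
  simp [pd, fderiv_apply, Pi.single_apply]

lemma pd_add (i : Fin 4) {f g : (Fin 4 → ℝ) → ℝ} {x : Fin 4 → ℝ}
    (hf : DifferentiableAt ℝ f x) (hg : DifferentiableAt ℝ g x) :
    pd i (fun y => f y + g y) x = pd i f x + pd i g x := by
  simp [pd, fderiv_fun_add hf hg]

lemma pd_mul (i : Fin 4) {f g : (Fin 4 → ℝ) → ℝ} {x : Fin 4 → ℝ}
    (hf : DifferentiableAt ℝ f x) (hg : DifferentiableAt ℝ g x) :
    pd i (fun y => f y * g y) x = f x * pd i g x + g x * pd i f x := by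
  simp [pd, fderiv_fun_mul hf hg]

lemma pd_profile (a b p q s : ℝ) (i : Fin 4) (x : Fin 4 → ℝ) :
    pd i (profile a b p q s) x = 2 * halfGrad a b p q s x i := by
  unfold profile
  fin_cases i <;>
    simp (disch := fun_prop) [halfGrad, pow_two, pd_add, pd_mul, pd_coord] <;> ring

lemma pd_halfGrad (a b p q s : ℝ) (i j : Fin 4) (x : Fin 4 → ℝ) :
    pd i (fun y => halfGrad a b p q s y j) x = halfHess a b p q s x i j := by
  fin_cases j <;> fin_cases i <;>
    simp (disch := fun_prop) [halfGrad, halfHess, pow_two, div_eq_mul_inv, pd_add, pd_mul,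
      pd_coord] <;> ring

/-- The array of Christoffel symbols `Γ^k_{ij}` in closed form, where `d` stands for half the
gradient of `profile`. -/
def christoffel (d : Fin 4 → ℝ) (k i j : Fin 4) : ℝ :=
  if k = 0 then (if i = 3 then d j else if j = 3 then d i else 0)
  else if k = 3 then 0
  else if i = 3 then (if j = 3 then -d k else 0)
  else 0

lemma Gam_eq (a b p q s : ℝ) (k i j : Fin 4) :
    Gam a b p q s k i j = fun x => christoffel (halfGrad a b p q s x) k i j := by
  funext x
  have h0 : halfGrad a b p q s x 0 = 0 := rfl
  simp only [Gam, ginv_eq, gmat_eq]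
  fin_cases k <;> fin_cases i <;> fin_cases j <;>
    simp [Fin.sum_univ_four, christoffel, pd_profile, h0]

lemma pd_christoffel (a b p q s : ℝ) (c k i j : Fin 4) (x : Fin 4 → ℝ) :
    pd c (fun y => christoffel (halfGrad a b p q s y) k i j) x =
      christoffel (halfHess a b p q s x c) k i j := by
  unfold christoffel
  split_ifs <;> simp [pd_neg, pd_halfGrad]

lemma christoffel_quadratic {d : Fin 4 → ℝ} (hd : d 0 = 0) (i j k l : Fin 4) :
    ∑ m, (christoffel d i k m * christoffel d m l j
      - christoffel d i l m * christoffel d m k j) = 0 := by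
  simp only [Fin.sum_univ_four, christoffel]
  by_cases hk : k = 3 <;> by_cases hl : l = 3 <;> by_cases hj : j = 3 <;>
    simp [hk, hl, hj, hd]

/-- The curvature component `R^i_{jk4}` for `k ≠ 4` in closed form, where `h` stands for half the
Hessian matrix of `profile`. -/
def curvatureBlock (h : Matrix (Fin 4) (Fin 4) ℝ) (i j k : Fin 4) : ℝ :=
  if i = 0 then (if j = 3 then 0 else h k j)
  else if i = 3 then 0
  else if j = 3 then -h k i
  else 0

/-- The curvature `R^i_{jkl}` in closed form: it vanishes unless exactly one of `k`, `l` is the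
index of `x⁴`. -/
def curvature (h : Matrix (Fin 4) (Fin 4) ℝ) (i j k l : Fin 4) : ℝ :=
  if l = 3 then (if k = 3 then 0 else curvatureBlock h i j k)
  else if k = 3 then -curvatureBlock h i j l
  else 0

lemma halfHess_symm (a b p q s : ℝ) (x : Fin 4 → ℝ) (i j : Fin 4) :
    halfHess a b p q s x i j = halfHess a b p q s x j i := by
  fin_cases i <;> fin_cases j <;> rfl

lemma Riem_eq (a b p q s : ℝ) (i j k l : Fin 4) (x : Fin 4 → ℝ) :
    Riem a b p q s i j k l x = curvature (halfHess a b p q s x) i j k l := by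
  simp only [Riem, Gam_eq, pd_christoffel]
  rw [christoffel_quadratic rfl]
  have hs := halfHess_symm a b p q s x
  generalize halfHess a b p q s x = h at hs
  simp only [christoffel, curvature, curvatureBlock]
  by_cases hk : k = 3 <;> by_cases hl : l = 3 <;> by_cases hj : j = 3 <;>
    by_cases hi : i = 0 <;> simp [hi, hk, hl, hj, hs k l, hs k 3, hs l 3]

lemma Ric_eq (a b p q s : ℝ) (j l : Fin 4) (x : Fin 4 → ℝ) :
    Ric a b p q s j l x =
      if j = 3 ∧ l = 3 then -((a * x 3 + p) + (b * x 3 + s)) else 0 := by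
  simp only [Ric, Riem_eq]
  fin_cases j <;> fin_cases l <;>
    simp [Fin.sum_univ_four, curvature, curvatureBlock, halfHess]
  ring

lemma scal_eq (a b p q s : ℝ) (x : Fin 4 → ℝ) : scal a b p q s x = 0 := by
  simp [scal, ginv_eq, Ric_eq, Fin.sum_univ_four]

lemma Weyl_eq (a b p q s : ℝ) (i j k h : Fin 4) (x : Fin 4 → ℝ) :
    Weyl a b p q s i j k h x =
      ∑ m, gmat a b p q s x i m * curvature (halfHess a b p q s x) m j k h
        - (1 / 2) * (gmat a b p q s x i k * Ric a b p q s j h x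
          + gmat a b p q s x j h * Ric a b p q s i k x
          - gmat a b p q s x i h * Ric a b p q s j k x
          - gmat a b p q s x j k * Ric a b p q s i h x) := by
  simp [Weyl, Rlow, Riem_eq, scal_eq]

lemma Weyl_1313 (a b p q s : ℝ) (x : Fin 4 → ℝ) :
    Weyl a b p q s 1 3 1 3 x = ((b - a) * x 3 + (s - p)) / 2 := by
  simp [Weyl_eq, gmat_eq, Ric_eq, Fin.sum_univ_four, curvature, curvatureBlock, halfHess]
  ring

lemma Weyl_1323 (a b p q s : ℝ) (x : Fin 4 → ℝ) :
    Weyl a b p q s 1 3 2 3 x = -q := by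
  simp [Weyl_eq, gmat_eq, Ric_eq, Fin.sum_univ_four, curvature, curvatureBlock, halfHess]

lemma Weyl_eq_zero (a p : ℝ) (i j k h : Fin 4) (x : Fin 4 → ℝ) :
    Weyl a a p 0 p i j k h x = 0 := by
  simp only [Weyl_eq, gmat_eq, Ric_eq]
  fin_cases i <;> fin_cases j <;> fin_cases k <;> fin_cases h <;>
    simp [Fin.sum_univ_four, curvature, curvatureBlock, halfHess] <;> ring

/-- `g` is conformally flat (the Weyl tensor vanishes identically)
iff `b = a`, `s = p` and `q = 0`. -/
theorem conformally_flat_iff (a b p q s : ℝ) :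
    (∀ (x : Fin 4 → ℝ) (i j k h : Fin 4), Weyl a b p q s i j k h x = 0) ↔
      (b = a ∧ s = p ∧ q = 0) := by
  constructor
  · intro H
    have h0 := H 0 1 3 1 3
    have h1 := H (fun _ => 1) 1 3 1 3
    have hq := H 0 1 3 2 3
    rw [Weyl_1313] at h0 h1
    rw [Weyl_1323] at hq
    simp only [Pi.zero_apply] at h0
    refine ⟨?_, ?_, ?_⟩ <;> linarith
  · rintro ⟨rfl, rfl, rfl⟩ x i j k h
    exact Weyl_eq_zero _ _ i j k h x
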